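/- arXiv:1503.08090 — 2 statements merged into one kernel-verified Lean document; each statement's English description precedes it below -/
import Mathlib

section
/- Let w^∞ : P → ℝ be the pointwise limit of the policy iteration sequence (w^k). Then F♭(w^∞)(p) ≤ w^∞(p) for all p ∈ P. -/
open MvPolynomial Filter

noncomputable section

abbrev MvPoly (d : ℕ) := MvPolynomial (Fin d) ℝ

/-- `q` is a sum of squares of polynomials (`q ∈ Σ[x]`). -/
def IsSOS {d : ℕ} (q : MvPoly d) : Prop :=
  ∃ (n : ℕ) (g : Fin n → MvPoly d), q = ∑ j, g j ^ 2

/-- The map `ℝ^d → ℝ^d` whose components are the polynomials `T j`. -/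
def polyMapApply {d : ℕ} (T : Fin d → MvPoly d) (x : Fin d → ℝ) : Fin d → ℝ :=
  fun j => eval x (T j)

/-- Degree of a polynomial map: the maximum total degree of its components. -/
def degMap {d : ℕ} (T : Fin d → MvPoly d) : ℕ :=
  Finset.univ.sup fun j => (T j).totalDegree

/-- `ur : P → ℝ` is the real-valued representative of `u : P → ℝ̄`. -/
def RealRep {ιP : Type} (u : ιP → EReal) (ur : ιP → ℝ) : Prop :=
  ∀ p, Real.toEReal (ur p) = u p

/-- Context: a constrained piecewise discrete-time polynomial system together with
a finite basis of polynomial templates of degree at most `2m`. -/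
structure PPSCtx (d m : ℕ) (I ιP : Type) [Fintype I] [Fintype ιP] where
  nI : I → ℕ
  rI : (i : I) → Fin (nI i) → MvPoly d
  n0 : ℕ
  r0 : Fin n0 → MvPoly d
  nin : ℕ
  rin : Fin nin → MvPoly d
  T : I → Fin d → MvPoly d
  tmpl : ιP → MvPoly d
  htmpl : ∀ p, (tmpl p).totalDegree ≤ 2 * m

namespace PPSCtx

variable {d m : ℕ} {I ιP : Type} [Fintype I] [Fintype ιP] (S : PPSCtx d m I ιP)

def Xi (i : I) : Set (Fin d → ℝ) := {x | ∀ j, eval x (S.rI i j) ≤ 0}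

def X0 : Set (Fin d → ℝ) := {x | ∀ k, eval x (S.r0 k) ≤ 0}

def Xin : Set (Fin d → ℝ) := {x | ∀ j, eval x (S.rin j) ≤ 0}

def wStar (w : ιP → ℝ) : Set (Fin d → ℝ) := {x | ∀ p, eval x (S.tmpl p) ≤ w p}

/-- `F♯_i(w)(p)`. -/
def FsharpI (w : ιP → ℝ) (i : I) (p : ιP) : EReal :=
  ⨆ x ∈ S.wStar w ∩ S.Xi i ∩ S.X0,
    Real.toEReal (eval (polyMapApply (S.T i) x) (S.tmpl p))

/-- `X^in†(p)`. -/
def XinDag (p : ιP) : EReal :=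
  ⨆ x ∈ S.Xin, Real.toEReal (eval x (S.tmpl p))

/-- The SOS certificate constraints witnessing the bound `η` in `F_i♭(w)(p)`. -/
def FibWitness (w : ιP → ℝ) (i : I) (p : ιP) (η : ℝ) (lam : ιP → ℝ)
    (σ : MvPoly d) (μ : Fin (S.nI i) → MvPoly d) (γ : Fin S.n0 → MvPoly d) : Prop :=
  (∀ q, 0 ≤ lam q) ∧ IsSOS σ ∧ (∀ l, IsSOS (μ l)) ∧ (∀ l, IsSOS (γ l)) ∧
  (C η - aeval (S.T i) (S.tmpl p) - (∑ q, C (lam q) * (C (w q) - S.tmpl q))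
      + (∑ l, μ l * S.rI i l) + (∑ l, γ l * S.r0 l) = σ) ∧
  σ.totalDegree ≤ 2 * m * degMap (S.T i) ∧
  ((∑ l, μ l * S.rI i l) + (∑ l, γ l * S.r0 l)).totalDegree ≤ 2 * m * degMap (S.T i)

/-- `F_i♭(w)(p)`. -/
def Fib (w : ιP → ℝ) (i : I) (p : ιP) : EReal :=
  sInf (Real.toEReal '' {η : ℝ | ∃ lam σ μ γ, S.FibWitness w i p η lam σ μ γ})

/-- `X^in♭(p)`. -/
def Xinb (p : ιP) : EReal :=
  sInf (Real.toEReal '' {η : ℝ | ∃ (σ₀ : MvPoly d) (ν : Fin S.nin → MvPoly d),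
    IsSOS σ₀ ∧ (∀ j, IsSOS (ν j)) ∧
    (C η - S.tmpl p + ∑ j, ν j * S.rin j = σ₀) ∧
    σ₀.totalDegree ≤ 2 * m ∧ (∑ j, ν j * S.rin j).totalDegree ≤ 2 * m})

/-- `F♭(w)(p)`. -/
def Fb (w : ιP → ℝ) (p : ιP) : EReal :=
  max (⨆ i, S.Fib w i p) (S.Xinb p)

/-- `Sol(w,i,p)`: feasible tuples attaining the infimum `F_i♭(w)(p)`. -/
def Sol (w : ιP → ℝ) (i : I) (p : ιP) (lam : ιP → ℝ)
    (σ : MvPoly d) (μ : Fin (S.nI i) → MvPoly d) (γ : Fin S.n0 → MvPoly d) : Prop :=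
  ∃ η : ℝ, S.FibWitness w i p η lam σ μ γ ∧ Real.toEReal η = S.Fib w i p

/-- `FS`: template bounds for which `Sol(w,i,p)` is nonempty for all `i`, `p`. -/
def FS (w : ιP → ℝ) : Prop :=
  ∀ (i : I) (p : ιP), ∃ lam σ μ γ, S.Sol w i p lam σ μ γ

/-- `lamP` is the `λ`-part of a policy choice `π(w)`. -/
def IsPolicy (w : ιP → ℝ) (lamP : I → ιP → ιP → ℝ) : Prop :=
  ∀ (i : I) (p : ιP), ∃ σ μ γ, S.Sol w i p (lamP i p) σ μ γ

/-- `φ_{w,i,p}^λ(v)` for `v : P → ℝ̄`. -/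
def phiE (w : ιP → ℝ) (lam : ιP → ℝ) (i : I) (p : ιP) (v : ιP → EReal) : EReal :=
  (∑ q, Real.toEReal (lam q) * v q) + S.Fib w i p - Real.toEReal (∑ q, lam q * w q)

/-- `Φ_w^{π(w)}(v)(p)`. -/
def PhiE (w : ιP → ℝ) (lamP : I → ιP → ιP → ℝ) (v : ιP → EReal) (p : ιP) : EReal :=
  max (⨆ i, S.phiE w (lamP i p) i p v) (S.Xinb p)

/-- The least fixpoint of `Φ_w^{π(w)}` on the complete lattice `P → ℝ̄`
(by the Knaster–Tarski theorem, the infimum of the post-fixpoints). -/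
def lfpPhi (w : ιP → ℝ) (lamP : I → ιP → ιP → ℝ) : ιP → EReal :=
  sInf {v : ιP → EReal | ∀ p, S.PhiE w lamP v p ≤ v p}

/-- The policy iteration sequence. -/
def IsPolicySeq (W : ℕ → ιP → EReal) : Prop :=
  (∃ w0 : ιP → ℝ, RealRep (W 0) w0 ∧ ∀ p, S.Fb w0 p ≤ Real.toEReal (w0 p)) ∧
  (∀ p, ∃ r : ℝ, S.Xinb p = Real.toEReal r) ∧
  (∀ k : ℕ,
    (∀ wr : ιP → ℝ, RealRep (W k) wr → S.FS wr →
      ∃ lamP, S.IsPolicy wr lamP ∧ W (k + 1) = S.lfpPhi wr lamP) ∧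
    ((¬ ∃ wr : ιP → ℝ, RealRep (W k) wr ∧ S.FS wr) → W (k + 1) = W k))

end PPSCtx

namespace PPSCtx

variable {d m : ℕ} {I ιP : Type} [Fintype I] [Fintype ιP] (S : PPSCtx d m I ιP)

/-- A certificate at `w` is a certificate at `v` for the bound shifted by `λ · (v - w)`. -/
lemma FibWitness.shift {S : PPSCtx d m I ιP} {w : ιP → ℝ} {i : I} {p : ιP} {η : ℝ}
    {lam : ιP → ℝ} {σ : MvPoly d} {μ : Fin (S.nI i) → MvPoly d} {γ : Fin S.n0 → MvPoly d}
    (h : S.FibWitness w i p η lam σ μ γ) (v : ιP → ℝ) :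
    S.FibWitness v i p (η + ∑ q, lam q * (v q - w q)) lam σ μ γ := by
  obtain ⟨h1, h2, h3, h4, h5, h6⟩ := h
  refine ⟨h1, h2, h3, h4, ?_, h6⟩
  rw [← h5]
  have key : ∑ q, (C (lam q) : MvPoly d) * (C (v q) - S.tmpl q)
      = ∑ q, C (lam q) * (C (w q) - S.tmpl q) + C (∑ q, lam q * (v q - w q)) := by
    rw [map_sum, ← Finset.sum_add_distrib]
    refine Finset.sum_congr rfl fun q _ => ?_
    simp only [C_mul, C_sub]
    ring
  rw [key, C_add]
  ring

lemma Fib_le_of_witness {w : ιP → ℝ} {i : I} {p : ιP} {η : ℝ} {lam : ιP → ℝ} {σ : MvPoly d}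
    {μ : Fin (S.nI i) → MvPoly d} {γ : Fin S.n0 → MvPoly d}
    (h : S.FibWitness w i p η lam σ μ γ) : S.Fib w i p ≤ Real.toEReal η :=
  sInf_le ⟨η, ⟨lam, σ, μ, γ, h⟩, rfl⟩

lemma Fib_mono {v w : ιP → ℝ} (hvw : v ≤ w) (i : I) (p : ιP) :
    S.Fib v i p ≤ S.Fib w i p := by
  refine le_sInf ?_
  rintro _ ⟨η, ⟨lam, σ, μ, γ, h⟩, rfl⟩
  refine (S.Fib_le_of_witness (h.shift v)).trans (EReal.coe_le_coe_iff.2 ?_)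
  have : ∑ q, lam q * (v q - w q) ≤ 0 := Finset.sum_nonpos fun q _ =>
    mul_nonpos_of_nonneg_of_nonpos (h.1 q) (sub_nonpos.2 (hvw q))
  linarith

lemma Fb_mono {v w : ιP → ℝ} (hvw : v ≤ w) (p : ιP) : S.Fb v p ≤ S.Fb w p :=
  max_le_max_right _ (iSup_mono fun i => S.Fib_mono hvw i p)

lemma phiE_coe {w : ιP → ℝ} {i : I} {p : ιP} {η : ℝ} (hη : Real.toEReal η = S.Fib w i p)
    (lam v : ιP → ℝ) :
    S.phiE w lam i p (fun q => Real.toEReal (v q))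
      = Real.toEReal (η + ∑ q, lam q * (v q - w q)) := by
  have hsum : ∑ q, Real.toEReal (lam q) * Real.toEReal (v q)
      = Real.toEReal (∑ q, lam q * v q) := by
    simp only [← EReal.coe_mul]
    exact (map_sum (⟨⟨Real.toEReal, EReal.coe_zero⟩, EReal.coe_add⟩ : ℝ →+ EReal) _ _).symm
  rw [phiE, ← hη, hsum, ← EReal.coe_add, ← EReal.coe_sub]
  congr 1
  simp only [mul_sub, Finset.sum_sub_distrib]
  ring

lemma phiE_mono {w lam : ιP → ℝ} (hlam : ∀ q, 0 ≤ lam q) (i : I) (p : ιP)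
    {u v : ιP → EReal} (huv : u ≤ v) : S.phiE w lam i p u ≤ S.phiE w lam i p v := by
  refine EReal.sub_le_sub (add_le_add_left (Finset.sum_le_sum fun q _ => ?_) _) le_rfl
  exact mul_le_mul_of_nonneg_left (huv q) (EReal.coe_nonneg.2 (hlam q))

section Policy

variable {S} {w : ιP → ℝ} {lamP : I → ιP → ιP → ℝ}

lemma IsPolicy.Fb_le_PhiE (h : S.IsPolicy w lamP) (v : ιP → ℝ) (p : ιP) :
    S.Fb v p ≤ S.PhiE w lamP (fun q => Real.toEReal (v q)) p := by
  refine max_le_max_right _ (iSup_mono fun i => ?_)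
  obtain ⟨σ, μ, γ, η, hw, hη⟩ := h i p
  rw [S.phiE_coe hη]
  exact S.Fib_le_of_witness (hw.shift v)

lemma IsPolicy.PhiE_self (h : S.IsPolicy w lamP) (p : ιP) :
    S.PhiE w lamP (fun q => Real.toEReal (w q)) p = S.Fb w p := by
  unfold PhiE Fb
  congr 1
  refine iSup_congr fun i => ?_
  obtain ⟨σ, μ, γ, η, -, hη⟩ := h i p
  rw [S.phiE_coe hη, ← hη]
  simp

lemma IsPolicy.PhiE_mono (h : S.IsPolicy w lamP) {u v : ιP → EReal} (huv : u ≤ v) (p : ιP) :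
    S.PhiE w lamP u p ≤ S.PhiE w lamP v p := by
  refine max_le_max_right _ (iSup_mono fun i => ?_)
  obtain ⟨σ, μ, γ, η, hw, -⟩ := h i p
  exact S.phiE_mono hw.1 i p huv

lemma IsPolicy.PhiE_lfpPhi_le (h : S.IsPolicy w lamP) (p : ιP) :
    S.PhiE w lamP (S.lfpPhi w lamP) p ≤ S.lfpPhi w lamP p := by
  have key : S.PhiE w lamP (S.lfpPhi w lamP) ≤ S.lfpPhi w lamP :=
    le_sInf fun v hv q => (h.PhiE_mono (sInf_le hv) q).trans (hv q)
  exact key p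

end Policy

/-- One step of policy iteration decreases the bounds and preserves `F♭(w) ≤ w`. -/
lemma IsPolicySeq.step {S : PPSCtx d m I ιP} {W : ℕ → ιP → EReal} (hseq : S.IsPolicySeq W)
    {k : ℕ} {v w : ιP → ℝ} (hw : RealRep (W k) w) (hv : RealRep (W (k + 1)) v)
    (hF : ∀ p, S.Fb w p ≤ Real.toEReal (w p)) :
    v ≤ w ∧ ∀ p, S.Fb v p ≤ Real.toEReal (v p) := by
  have hveq : W (k + 1) = fun p => Real.toEReal (v p) := funext fun p => (hv p).symm
  by_cases hFS : S.FS w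
  · obtain ⟨lamP, hpol, hstep⟩ := (hseq.2.2 k).1 w hw hFS
    have hlfp : S.lfpPhi w lamP = fun p => Real.toEReal (v p) := hstep.symm.trans hveq
    constructor
    · have hle : S.lfpPhi w lamP ≤ fun p => Real.toEReal (w p) :=
        sInf_le fun p => (hpol.PhiE_self p).trans_le (hF p)
      rw [hlfp] at hle
      exact fun p => EReal.coe_le_coe_iff.1 (hle p)
    · intro p
      have hpost := hpol.PhiE_lfpPhi_le p
      rw [hlfp] at hpost
      exact (hpol.Fb_le_PhiE v p).trans hpost
  · have hno : ¬ ∃ u : ιP → ℝ, RealRep (W k) u ∧ S.FS u := by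
      rintro ⟨u, hu, hFSu⟩
      have : u = w := funext fun p => EReal.coe_injective ((hu p).trans (hw p).symm)
      exact hFS (this ▸ hFSu)
    have hstep := (hseq.2.2 k).2 hno
    have hvw : v = w := funext fun p => EReal.coe_injective <| by
      rw [hv p, hw p, hstep]
    subst hvw
    exact ⟨le_rfl, hF⟩

end PPSCtx

/-- part 3 of Theorem 1, first half: the pointwise limit `w^∞` of the
policy iteration sequence satisfies `F♭(w^∞) ≤ w^∞`. -/
theorem stmt17 {d m : ℕ} {I ιP : Type} [Fintype I] [Fintype ιP]
    (S : PPSCtx d m I ιP) (W : ℕ → ιP → EReal) (hseq : S.IsPolicySeq W)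
    (wr : ℕ → ιP → ℝ) (hwr : ∀ k, RealRep (W k) (wr k))
    (winf : ιP → ℝ)
    (hlim : ∀ p, Filter.Tendsto (fun k => wr k p) Filter.atTop (nhds (winf p))) :
    ∀ p, S.Fb winf p ≤ Real.toEReal (winf p) := by
  have hF : ∀ k p, S.Fb (wr k) p ≤ Real.toEReal (wr k p) := by
    intro k
    induction k with
    | zero =>
      obtain ⟨w0, hw0, h0⟩ := hseq.1
      have : wr 0 = w0 := funext fun p => EReal.coe_injective ((hwr 0 p).trans (hw0 p).symm)
      exact this ▸ h0
    | succ k ih => exact (hseq.step (hwr k) (hwr (k + 1)) ih).2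
  have hanti : Antitone wr :=
    antitone_nat_of_succ_le fun k => (hseq.step (hwr k) (hwr (k + 1)) (hF k)).1
  intro p
  have hle : ∀ k, winf ≤ wr k := fun k q =>
    Antitone.le_of_tendsto (fun _ _ h => hanti h q) (hlim q) k
  exact ge_of_tendsto' ((continuous_coe_real_ereal.tendsto _).comp (hlim p))
    fun k => (S.Fb_mono (hle k) p).trans (hF k p)
end
end

section
/- Suppose p is a real polynomial in d variables for which there exist σ₀, σ_1,…,σ_{n_in} ∈ Σ[x] with −p = σ₀ − Σ_{j=1}^{n_in} σ_j r^in_j, and for each i ∈ I there exist σ^i, μ^i_1,…,μ^i_{n_i}, γ^i_1,…,γ^i_{n_0} ∈ Σ[x] with p − p∘T^i = σ^i − Σ_{j=1}^{n_i} μ^i_j r^i_j − Σ_{j=1}^{n_0} γ^i_j r^0_j. Then the set S = {x ∈ ℝ^d : p(x) ≤ 0} is an inductive invariant, i.e. F(S) ⊆ S, and consequently R ⊆ S. -/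
open MvPolynomial Filter

noncomputable section

theorem IsSOS.eval_nonneg {d : ℕ} {q : MvPoly d} (hq : IsSOS q) (x : Fin d → ℝ) :
    0 ≤ eval x q := by
  obtain ⟨n, g, rfl⟩ := hq
  simp only [map_sum, map_pow]
  exact Finset.sum_nonneg fun j _ => sq_nonneg _

/-- An SOS-weighted sum of constraints is nonpositive wherever the constraints hold. -/
theorem eval_sum_sos_mul_nonpos {d : ℕ} {ι : Type*} [Fintype ι] {σ r : ι → MvPoly d}
    (hσ : ∀ j, IsSOS (σ j)) {x : Fin d → ℝ} (hx : ∀ j, eval x (r j) ≤ 0) :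
    eval x (∑ j, σ j * r j) ≤ 0 := by
  simp only [map_sum, map_mul]
  exact Finset.sum_nonpos fun j _ =>
    mul_nonpos_of_nonneg_of_nonpos ((hσ j).eval_nonneg x) (hx j)

theorem eval_aeval_eq_eval_polyMapApply {d : ℕ} (T : Fin d → MvPoly d) (p : MvPoly d)
    (x : Fin d → ℝ) : eval x (aeval T p) = eval (polyMapApply T x) p := by
  induction p using MvPolynomial.induction_on with
  | C a => simp only [algHom_C, algebraMap_eq, eval_C]
  | add p q hp hq => simp only [map_add, hp, hq]
  | mul_X p j hp => simp only [map_mul, hp, aeval_X, eval_X, polyMapApply]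

/-- Prop. 1 of [SAS1], used for initialization: an SOS certificate for the
single template `p` makes `S = {x | p(x) ≤ 0}` an inductive invariant (`F(S) ⊆ S`),
and hence an over-approximation of the reachable value set `R`. -/
theorem stmt19 {d : ℕ} {I : Type} [Fintype I]
    {nI : I → ℕ} (rI : (i : I) → Fin (nI i) → MvPoly d)
    {n0 : ℕ} (r0 : Fin n0 → MvPoly d)
    {nin : ℕ} (rin : Fin nin → MvPoly d)
    (T : I → Fin d → MvPoly d)
    (hcover : ∀ x : Fin d → ℝ, ∃ i : I, ∀ j, eval x (rI i j) ≤ 0)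
    (hdisj : ∀ i i' : I, i ≠ i' →
      {x : Fin d → ℝ | ∀ j, eval x (rI i j) ≤ 0} ∩
        {x : Fin d → ℝ | ∀ j, eval x (rI i' j) ≤ 0} = ∅)
    (Tfun : (Fin d → ℝ) → (Fin d → ℝ))
    (hT : ∀ (i : I) (x : Fin d → ℝ), (∀ j, eval x (rI i j) ≤ 0) →
      Tfun x = polyMapApply (T i) x)
    (p : MvPoly d)
    (σ₀ : MvPoly d) (σin : Fin nin → MvPoly d)
    (hσ₀ : IsSOS σ₀) (hσin : ∀ j, IsSOS (σin j))
    (hcert0 : -p = σ₀ - ∑ j, σin j * rin j)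
    (σI : I → MvPoly d) (μ : (i : I) → Fin (nI i) → MvPoly d) (γ : I → Fin n0 → MvPoly d)
    (hσI : ∀ i, IsSOS (σI i)) (hμ : ∀ i l, IsSOS (μ i l)) (hγ : ∀ i l, IsSOS (γ i l))
    (hcert : ∀ i, p - aeval (T i) p
        = σI i - (∑ j, μ i j * rI i j) - ∑ j, γ i j * r0 j) :
    let Xi : I → Set (Fin d → ℝ) := fun i => {x | ∀ j, eval x (rI i j) ≤ 0}
    let X0 : Set (Fin d → ℝ) := {x | ∀ k, eval x (r0 k) ≤ 0}
    let Xin : Set (Fin d → ℝ) := {x | ∀ j, eval x (rin j) ≤ 0}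
    let Sinv : Set (Fin d → ℝ) := {x | eval x p ≤ 0}
    let F : Set (Fin d → ℝ) → Set (Fin d → ℝ) :=
      fun C => (⋃ i, polyMapApply (T i) '' (C ∩ X0 ∩ Xi i)) ∪ Xin
    let G : Set (Fin d → ℝ) → Set (Fin d → ℝ) := fun s => Tfun '' (s ∩ X0)
    F Sinv ⊆ Sinv ∧ (⋃ k : ℕ, G^[k] Xin) ⊆ Sinv := by
  intro Xi X0 Xin Sinv F G
  have hinit : Xin ⊆ Sinv := by
    intro x hx
    have h := congrArg (eval x) hcert0
    rw [map_neg, map_sub] at h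
    have h0 := hσ₀.eval_nonneg x
    have h1 := eval_sum_sos_mul_nonpos hσin hx
    change eval x p ≤ 0
    linarith
  have hstep : ∀ i x, x ∈ Sinv → x ∈ X0 → x ∈ Xi i → polyMapApply (T i) x ∈ Sinv := by
    intro i x hxS hx0 hxi
    have h := congrArg (eval x) (hcert i)
    rw [map_sub, map_sub, map_sub, eval_aeval_eq_eval_polyMapApply] at h
    have h0 := (hσI i).eval_nonneg x
    have h1 := eval_sum_sos_mul_nonpos (hμ i) hxi
    have h2 := eval_sum_sos_mul_nonpos (hγ i) hx0
    change eval x p ≤ 0 at hxS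
    change eval (polyMapApply (T i) x) p ≤ 0
    linarith
  refine ⟨Set.union_subset (Set.iUnion_subset fun i => ?_) hinit, Set.iUnion_subset fun k => ?_⟩
  · rintro _ ⟨x, ⟨⟨hxS, hx0⟩, hxi⟩, rfl⟩
    exact hstep i x hxS hx0 hxi
  · induction k with
    | zero => exact hinit
    | succ k ih =>
      rw [Function.iterate_succ_apply']
      rintro _ ⟨x, ⟨hx, hx0⟩, rfl⟩
      obtain ⟨i, hi⟩ := hcover x
      rw [hT i x hi]
      exact hstep i x (ih hx) hx0 hi
end
end
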